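/- Let T = (e₁,…,e₅) be a list of five 4-tuples of pairwise distinct indices in {1,…,8} covering every index. Suppose some tuple eᵢ contains two distinct vertices each of degree 1 with respect to T. Then the cross-ratio degree of T is 0: there exists a nonzero polynomial q ∈ ℂ[x₁,…,x₅] such that N_T(a) = 0 for every a ∈ (ℂ∖{0,1})⁵ with q(a) ≠ 0. -/

import Mathlib

open OnePoint

/-- Cross-ratio of four points of `ℙ¹(ℂ) = OnePoint ℂ`:
`CR(z₁,z₂,z₃,z₄) = ((z₃−z₁)(z₄−z₂))/((z₃−z₂)(z₄−z₁))` when all points are finite,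
extended to one point at infinity by omitting the two factors containing it. -/
noncomputable def CR : OnePoint ℂ → OnePoint ℂ → OnePoint ℂ → OnePoint ℂ → ℂ
  | Option.none,    Option.some z₂, Option.some z₃, Option.some z₄ => (z₄ - z₂) / (z₃ - z₂)
  | Option.some z₁, Option.none,    Option.some z₃, Option.some z₄ => (z₃ - z₁) / (z₄ - z₁)
  | Option.some z₁, Option.some z₂, Option.none,    Option.some z₄ => (z₄ - z₂) / (z₄ - z₁)
  | Option.some z₁, Option.some z₂, Option.some z₃, Option.none    => (z₃ - z₁) / (z₃ - z₂)
  | Option.some z₁, Option.some z₂, Option.some z₃, Option.some z₄ =>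
      ((z₃ - z₁) * (z₄ - z₂)) / ((z₃ - z₂) * (z₄ - z₁))
  | _, _, _, _ => 0

/-- The degree of a vertex `v` with respect to the datum `T`:
the number of indices `i` such that `v` occurs in the tuple `eᵢ = T i`. -/
def degT (T : Fin 5 → Fin 4 → Fin 8) (v : Fin 8) : ℕ :=
  (Finset.univ.filter fun i => ∃ j, T i j = v).card

/-- `card ι` rational functions in `card σ < card ι` variables satisfy a nontrivial polynomial
relation, which holds at every point where all the denominators are nonzero. -/
lemma MvPolynomial.exists_ne_zero_eval_div_eq_zero {σ ι : Type} [Fintype σ] [Fintype ι]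
    (h : Fintype.card σ < Fintype.card ι) (num den : ι → MvPolynomial σ ℂ) :
    ∃ q : MvPolynomial ι ℂ, q ≠ 0 ∧ ∀ t : σ → ℂ, (∀ i, MvPolynomial.eval t (den i) ≠ 0) →
      MvPolynomial.eval (fun i => MvPolynomial.eval t (num i) / MvPolynomial.eval t (den i)) q
        = 0 := by
  classical
  set D := ∏ i, den i with hD
  by_cases hD0 : D = 0
  · refine ⟨1, one_ne_zero, fun t ht => absurd (congrArg (MvPolynomial.eval t) hD0) ?_⟩
    simpa [hD, map_prod, Finset.prod_eq_zero_iff] using ht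
  let A := Localization.Away D
  have hle : Submonoid.powers D ≤ nonZeroDivisors (MvPolynomial σ ℂ) :=
    powers_le_nonZeroDivisors_of_noZeroDivisors hD0
  have : IsDomain A := IsLocalization.isDomain_localization hle
  have : FaithfulSMul (MvPolynomial σ ℂ) A :=
    (faithfulSMul_iff_algebraMap_injective _ _).2 (IsLocalization.injective A hle)
  have : Algebra.IsAlgebraic (MvPolynomial σ ℂ) A :=
    IsLocalization.isAlgebraic _ (Submonoid.powers D)
  have htr : Algebra.trdeg ℂ A = Fintype.card σ := by
    rw [← trdeg_add_eq ℂ (MvPolynomial σ ℂ) (A := A),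
      trdeg_eq_zero (R := MvPolynomial σ ℂ),
      MvPolynomial.trdeg_of_isDomain]
    simp
  have hu : ∀ i, IsUnit (algebraMap (MvPolynomial σ ℂ) A (den i)) := fun i =>
    isUnit_of_dvd_unit (map_dvd _ (Finset.dvd_prod_of_mem den (Finset.mem_univ i)))
      (IsLocalization.Away.algebraMap_isUnit D)
  choose u hu using hu
  let f : ι → A := fun i => algebraMap (MvPolynomial σ ℂ) A (num i) * ↑(u i)⁻¹
  have hdep : ¬ AlgebraicIndependent ℂ f := fun hf => by
    have := hf.cardinalMk_le_trdeg
    rw [htr, Cardinal.mk_fintype] at this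
    exact absurd (by exact_mod_cast this) (not_le.2 h)
  rw [algebraicIndependent_iff] at hdep
  push Not at hdep
  obtain ⟨q, hq, hq0⟩ := hdep
  refine ⟨q, hq0, fun t ht => ?_⟩
  have hDt : IsUnit (MvPolynomial.aeval t D : ℂ) := by
    simpa [hD, map_prod, Finset.prod_eq_zero_iff, MvPolynomial.aeval_eq_eval] using ht
  let φ : A →ₐ[ℂ] ℂ := IsLocalization.liftAlgHom (M := Submonoid.powers D)
    (f := MvPolynomial.aeval t) (by rintro ⟨_, n, rfl⟩; simpa using hDt.pow n)
  have hφ : ∀ x, φ (algebraMap (MvPolynomial σ ℂ) A x) = MvPolynomial.eval t x := fun x => by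
    simp [φ]
  have hφf : ∀ i, φ (f i) = MvPolynomial.eval t (num i) / MvPolynomial.eval t (den i) :=
    fun i => by
      rw [eq_div_iff (ht i), ← hφ, ← hφ, ← map_mul, ← hu i, mul_assoc, Units.inv_mul, mul_one]
  have := congrArg φ hq
  rw [map_zero, MvPolynomial.comp_aeval_apply] at this
  simpa [hφf, MvPolynomial.aeval_eq_eval] using this

/-- The determinant of two vectors of length two. -/
def bracket {R : Type*} [CommRing R] (a b : R × R) : R := a.1 * b.2 - a.2 * b.1

/-- Homogeneous coordinates on `ℙ¹(ℂ)`. -/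
def homogCoord : OnePoint ℂ → ℂ × ℂ
  | Option.none => (1, 0)
  | Option.some z => (z, 1)

lemma bracket_homogCoord_ne_zero {x y : OnePoint ℂ} (h : x ≠ y) :
    bracket (homogCoord x) (homogCoord y) ≠ 0 := by
  rcases x with _ | x <;> rcases y with _ | y
  · exact absurd rfl h
  · simp [bracket, homogCoord]
  · simp [bracket, homogCoord]
  · have : x ≠ y := fun e => h (congrArg _ e)
    simpa [bracket, homogCoord, sub_eq_zero] using this

lemma CR_eq_bracket {x y z w : OnePoint ℂ} (hxy : x ≠ y) (hxz : x ≠ z) (hxw : x ≠ w)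
    (hyz : y ≠ z) (hyw : y ≠ w) (hzw : z ≠ w) :
    CR x y z w =
      (bracket (homogCoord z) (homogCoord x) * bracket (homogCoord w) (homogCoord y)) /
        (bracket (homogCoord z) (homogCoord y) * bracket (homogCoord w) (homogCoord x)) := by
  rcases x with _ | x <;> rcases y with _ | y <;> rcases z with _ | z <;> rcases w with _ | w <;>
    first
    | exact absurd rfl ‹_›
    | (simp [CR, bracket, homogCoord]; done)
    | (simp only [CR, bracket, homogCoord]; rw [← neg_div_neg_eq]; simp)

/-- The coordinates of a generic configuration whose points `u₁, u₂, u₃` are `∞, 0, 1`. -/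
noncomputable def genericCoord {α : Type} [DecidableEq α] (u₁ u₂ u₃ : α) (s : Finset α) (x : α) :
    MvPolynomial s ℂ × MvPolynomial s ℂ :=
  if x = u₁ then (1, 0) else if x = u₂ then (0, 1) else if x = u₃ then (1, 1)
  else if h : x ∈ s then (MvPolynomial.X ⟨x, h⟩, 1) else (0, 0)

/-- Every configuration of vectors in general position is, up to a linear map and rescaling,
a specialization of the generic one. -/
lemma exists_bracket_genericCoord {α : Type} [DecidableEq α] {u₁ u₂ u₃ : α} {s : Finset α}
    (P : α → ℂ × ℂ) (hP : ∀ x y, x ≠ y → bracket (P x) (P y) ≠ 0)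
    (h12 : u₁ ≠ u₂) (h13 : u₁ ≠ u₃) (h23 : u₂ ≠ u₃) :
    ∃ (t : s → ℂ) (c : α → ℂ) (δ : ℂ), δ ≠ 0 ∧ (∀ x, c x ≠ 0) ∧
      ∀ x y, (x = u₁ ∨ x = u₂ ∨ x = u₃ ∨ x ∈ s) → (y = u₁ ∨ y = u₂ ∨ y = u₃ ∨ y ∈ s) →
        c x * c y * MvPolynomial.eval t
          (bracket (genericCoord u₁ u₂ u₃ s x) (genericCoord u₁ u₂ u₃ s y)) =
          δ * bracket (P x) (P y) := by
  have n21 := hP _ _ h12.symm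
  have n12 := hP _ _ h12
  have n31 := hP _ _ h13.symm
  have n32 := hP _ _ h23.symm
  let Q : α → ℂ × ℂ := fun x =>
    (bracket (P x) (P u₂) * bracket (P u₃) (P u₁), bracket (P x) (P u₁) * bracket (P u₃) (P u₂))
  let c : α → ℂ := fun x => if x = u₁ then (Q x).1 else (Q x).2
  let t : s → ℂ := fun x => (Q x).1 / (Q x).2
  have hc : ∀ x, c x ≠ 0 := by
    intro x
    by_cases hx : x = u₁
    · subst hx
      simpa [c, Q] using ⟨n12, n31⟩
    · simpa [c, Q, hx] using ⟨hP _ _ hx, n32⟩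
  have key : ∀ x, (x = u₁ ∨ x = u₂ ∨ x = u₃ ∨ x ∈ s) →
      (Q x).1 = c x * MvPolynomial.eval t (genericCoord u₁ u₂ u₃ s x).1 ∧
      (Q x).2 = c x * MvPolynomial.eval t (genericCoord u₁ u₂ u₃ s x).2 := by
    intro x hx
    by_cases h1 : x = u₁
    · subst h1
      constructor
      · simp [c, genericCoord]
      · simp [Q, genericCoord, bracket, mul_comm]
    by_cases h2 : x = u₂
    · subst h2
      constructor
      · simp [Q, genericCoord, h1, bracket, mul_comm]
      · simp [c, genericCoord, h1]
    by_cases h3 : x = u₃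
    · subst h3
      constructor
      · simp [c, Q, genericCoord, h1, h2, mul_comm]
      · simp [c, genericCoord, h1, h2]
    have hs : x ∈ s := by tauto
    have hQ : (Q x).2 ≠ 0 := by simpa [c, h1] using hc x
    constructor
    · simp [c, genericCoord, h1, h2, h3, hs, t, mul_div_cancel₀ _ hQ]
    · simp [c, genericCoord, h1, h2, h3, hs]
  refine ⟨t, c, bracket (P u₂) (P u₁) * bracket (P u₃) (P u₁) * bracket (P u₃) (P u₂),
    mul_ne_zero (mul_ne_zero n21 n31) n32, hc, fun x y hx hy => ?_⟩
  have hQ : bracket (Q x) (Q y) = bracket (P u₂) (P u₁) * bracket (P u₃) (P u₁) *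
      bracket (P u₃) (P u₂) * bracket (P x) (P y) := by
    simp only [Q, bracket]
    ring
  obtain ⟨hx1, hx2⟩ := key x hx
  obtain ⟨hy1, hy2⟩ := key y hy
  rw [← hQ]
  simp only [bracket, hx1, hx2, hy1, hy2, map_sub, map_mul]
  ring

/-- If some tuple of the datum contains two distinct vertices of degree 1, then the
cross-ratio degree is 0. -/
theorem crossRatioDegree_eq_zero_of_two_deg_one_in_one_edge
    (T : Fin 5 → Fin 4 → Fin 8)
    (hT : ∀ i, Function.Injective (T i))
    (hcov : ∀ v : Fin 8, ∃ i j, T i j = v)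
    (h2 : ∃ (i : Fin 5) (v w : Fin 8), v ≠ w ∧ (∃ j, T i j = v) ∧ (∃ j, T i j = w) ∧
      degT T v = 1 ∧ degT T w = 1) :
    ∃ q : MvPolynomial (Fin 5) ℂ, q ≠ 0 ∧
      ∀ a : Fin 5 → ℂ, (∀ i, a i ≠ 0 ∧ a i ≠ 1) → MvPolynomial.eval a q ≠ 0 →
        ({p : Fin 8 → OnePoint ℂ | Function.Injective p ∧ p 0 = ∞ ∧
            p 1 = ((0 : ℂ) : OnePoint ℂ) ∧ p 2 = ((1 : ℂ) : OnePoint ℂ) ∧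
            ∀ i, CR (p (T i 0)) (p (T i 1)) (p (T i 2)) (p (T i 3)) = a i} :
          Set (Fin 8 → OnePoint ℂ)) = ∅ := by
  classical
  obtain ⟨i, v, w, hvw, hv, hw, dv, dw⟩ := h2
  have avoid : ∀ x, (∃ j, T i j = x) → degT T x = 1 → ∀ k, k ≠ i → ∀ j, T k j ≠ x := by
    intro x hx dx k hk j hj
    obtain ⟨m, hm⟩ := Finset.card_eq_one.1 dx
    have hi : i ∈ ({m} : Finset (Fin 5)) := hm ▸ by simpa using hx
    have hk' : k ∈ ({m} : Finset (Fin 5)) := hm ▸ by simpa using ⟨j, hj⟩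
    exact hk ((Finset.mem_singleton.1 hk').trans (Finset.mem_singleton.1 hi).symm)
  set S : Finset (Fin 8) := {v, w}ᶜ with hS
  have hScard : S.card = 6 := by
    rw [hS, Finset.card_compl, Finset.card_pair hvw, Fintype.card_fin]
  have hTS : ∀ k, k ≠ i → ∀ j, T k j ∈ S := fun k hk j => by
    simpa [hS] using ⟨avoid v hv dv k hk j, avoid w hw dw k hk j⟩
  obtain ⟨B, hBS, hB⟩ := Finset.exists_subset_card_eq (s := S) (n := 3) (by omega)
  obtain ⟨u₁, u₂, u₃, h12, h13, h23, rfl⟩ := Finset.card_eq_three.1 hB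
  set s : Finset (Fin 8) := S \ {u₁, u₂, u₃} with hs
  have hscard : s.card = 3 := by rw [hs, Finset.card_sdiff_of_subset hBS, hScard, hB]
  have hmem : ∀ x ∈ S, x = u₁ ∨ x = u₂ ∨ x = u₃ ∨ x ∈ s := fun x hx => by
    simp only [hs, Finset.mem_sdiff, Finset.mem_insert, Finset.mem_singleton]
    tauto
  let V := genericCoord u₁ u₂ u₃ s
  obtain ⟨q, hq0, hq⟩ := MvPolynomial.exists_ne_zero_eval_div_eq_zero
    (σ := s) (ι := {k : Fin 5 // k ≠ i}) (by simp [hscard])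
    (fun k => bracket (V (T k 2)) (V (T k 0)) * bracket (V (T k 3)) (V (T k 1)))
    (fun k => bracket (V (T k 2)) (V (T k 1)) * bracket (V (T k 3)) (V (T k 0)))
  refine ⟨MvPolynomial.rename Subtype.val q,
    (map_ne_zero_iff _ (MvPolynomial.rename_injective _ Subtype.val_injective)).2 hq0,
    fun a _ hqa => Set.eq_empty_iff_forall_notMem.2 ?_⟩
  rintro p ⟨hp, -, -, -, hCR⟩
  apply hqa
  have hP : ∀ x y, x ≠ y → bracket (homogCoord (p x)) (homogCoord (p y)) ≠ 0 :=
    fun x y hxy => bracket_homogCoord_ne_zero (hp.ne hxy)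
  obtain ⟨t, c, δ, hδ, hc, hV⟩ :=
    exists_bracket_genericCoord (s := s) (fun x => homogCoord (p x)) hP h12 h13 h23
  have hV' : ∀ x ∈ S, ∀ y ∈ S, MvPolynomial.eval t (bracket (V x) (V y)) =
      δ * bracket (homogCoord (p x)) (homogCoord (p y)) / (c x * c y) := fun x hx y hy => by
    rw [eq_div_iff (mul_ne_zero (hc x) (hc y)), mul_comm]
    exact hV x y (hmem x hx) (hmem y hy)
  have hne : ∀ k j j', j ≠ j' → T k j ≠ T k j' := fun k j j' h => (hT k).ne h
  rw [MvPolynomial.eval_rename]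
  convert hq t ?_ using 3
  · funext k
    have m := hTS k k.2
    have n21 := hP _ _ (hne k 2 1 (by decide))
    have n30 := hP _ _ (hne k 3 0 (by decide))
    rw [Function.comp_apply, ← hCR, CR_eq_bracket]
    · rw [map_mul, map_mul, hV' _ (m 2) _ (m 0), hV' _ (m 3) _ (m 1), hV' _ (m 2) _ (m 1),
        hV' _ (m 3) _ (m 0)]
      have c0 := hc (T k 0)
      have c1 := hc (T k 1)
      have c2 := hc (T k 2)
      have c3 := hc (T k 3)
      field_simp
    all_goals exact hp.ne (hne k _ _ (by decide))
  · intro k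
    have m := hTS k k.2
    rw [map_mul, hV' _ (m 2) _ (m 1), hV' _ (m 3) _ (m 0)]
    exact mul_ne_zero
      (div_ne_zero (mul_ne_zero hδ (hP _ _ (hne k _ _ (by decide)))) (mul_ne_zero (hc _) (hc _)))
      (div_ne_zero (mul_ne_zero hδ (hP _ _ (hne k _ _ (by decide)))) (mul_ne_zero (hc _) (hc _)))
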